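/- Let T_p : 𝕋 → 𝕋 be the map x ↦ px (mod 1) on the circle 𝕋 = ℝ/ℤ for an integer p ≥ 2, and let μ be a T_p-invariant Borel probability measure with h_μ(T_p) = 0. Then for every ε > 0 and every β > 0, there exist δ₀ > 0 and a Borel set X' ⊆ 𝕋 with μ(X') > 1 − ε such that for every 0 < δ ≤ δ₀ and every x ∈ X', μ(B_δ(x)) > δ^β, where B_δ(x) is the ball of radius δ centered at x. -/

import Mathlib

open MeasureTheory Filter

/-- The image in `ℝ/ℤ` of the real interval `(a, b]`. -/
noncomputable def arc (a b : ℝ) : Set (AddCircle (1:ℝ)) :=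
  (fun x : ℝ => (x : AddCircle (1:ℝ))) '' Set.Ioc a b

/-- The measure-theoretic entropy of `x ↦ p • x` on `ℝ/ℤ` with respect to `μ`, computed
using the generating partition into the `p` arcs `((j-1)/p, j/p]`; its `n`-th refinement
is the partition into the `p^n` arcs `(k/p^n, (k+1)/p^n]`. -/
noncomputable def padicEntropy (p : ℕ) (μ : Measure (AddCircle (1:ℝ))) : ℝ :=
  atTop.limsup (fun n : ℕ => (1 / (n : ℝ)) *
    ∑ k ∈ Finset.range (p ^ n),
      Real.negMulLog ((μ (arc ((k : ℝ) / (p : ℝ) ^ n) (((k : ℝ) + 1) / (p : ℝ) ^ n))).toReal))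


set_option linter.unusedSectionVars false

section Abstract

variable {X : Type*} [MeasurableSpace X]

/-- Garsia's running maximum of ergodic sums. -/
noncomputable def gM (T : X → X) (g : X → ℝ) : ℕ → X → ℝ
  | 0 => fun _ => 0
  | n + 1 => fun x => max 0 (g x + gM T g n (T x))

lemma gM_nonneg (T : X → X) (g : X → ℝ) (n : ℕ) (x : X) : 0 ≤ gM T g n x := by
  cases n <;> simp [gM]

lemma gM_mono (T : X → X) (g : X → ℝ) (n : ℕ) : ∀ x, gM T g n x ≤ gM T g (n + 1) x := by
  induction n with
  | zero => intro x; exact gM_nonneg _ _ _ _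
  | succ n ih =>
    intro x
    have := ih (T x)
    rw [gM, gM.eq_2 T g (n+1)]
    exact max_le_max le_rfl (by linarith)

lemma gM_measurable {T : X → X} (hT : Measurable T) {g : X → ℝ} (hg : Measurable g) (n : ℕ) :
    Measurable (gM T g n) := by
  induction n with
  | zero => exact measurable_const
  | succ n ih => exact measurable_const.max (hg.add (ih.comp hT))

lemma gM_bound (T : X → X) (g : X → ℝ) (C : ℝ) (hC : 0 ≤ C) (hg : ∀ x, g x ≤ C) (n : ℕ) :
    ∀ x, gM T g n x ≤ n * C := by
  induction n with
  | zero => intro x; simp [gM]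
  | succ n ih =>
    intro x
    have := ih (T x)
    have := hg x
    have h0 : 0 ≤ (n : ℝ) * C := by positivity
    rw [gM]
    push_cast
    exact max_le (by linarith) (by linarith)

lemma birkhoff_le_gM (T : X → X) (g : X → ℝ) (n : ℕ) :
    ∀ x, birkhoffSum T g n x ≤ gM T g n x := by
  induction n with
  | zero => intro x; simp [gM]
  | succ n ih =>
    intro x
    rw [birkhoffSum_succ', gM]
    have := ih (T x)
    exact le_max_of_le_right (by linarith)

lemma maxerg {μ : Measure X} [IsProbabilityMeasure μ] {T : X → X} (hT : MeasurePreserving T μ μ)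
    {f : X → ℝ} (hf : Measurable f) (C : ℝ) (hf0 : ∀ x, 0 ≤ f x) (hfC : ∀ x, f x ≤ C)
    {l : ℝ} (hl : 0 < l) :
    μ.real {x | ∃ n : ℕ, n * l < birkhoffSum T f n x} ≤ (∫ x, f x ∂μ) / l := by
  set g : X → ℝ := fun x => f x - l with hg
  have hgm : Measurable g := hf.sub_const l
  have hne : Nonempty X := by
    by_contra h
    rw [not_nonempty_iff] at h
    exact IsProbabilityMeasure.ne_zero μ (Measure.eq_zero_of_isEmpty μ)
  have hC0 : 0 ≤ C := (hf0 hne.some).trans (hfC _)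
  have hgC : ∀ x, g x ≤ C := fun x => by have := hfC x; simp only [hg]; linarith
  have hsum : ∀ (n : ℕ) x, birkhoffSum T g n x = birkhoffSum T f n x - n * l := by
    intro n x
    simp [birkhoffSum, hg, Finset.sum_sub_distrib]
  set E : ℕ → Set X := fun n => {x | 0 < gM T g (n + 1) x} with hE
  have hEm : ∀ n, MeasurableSet (E n) := fun n =>
    measurableSet_lt measurable_const (gM_measurable hT.measurable hgm _)
  have hEmono : Monotone E := monotone_nat_of_le_succ fun n x hx =>
    lt_of_lt_of_le hx (gM_mono T g _ x)
  have hsub : {x | ∃ n : ℕ, n * l < birkhoffSum T f n x} ⊆ ⋃ n, E n := by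
    rintro x ⟨n, hn⟩
    refine Set.mem_iUnion.2 ⟨n, ?_⟩
    have h1 := birkhoff_le_gM T g n x
    rw [hsum] at h1
    have h2 := gM_mono T g n x
    have h3 : 0 < gM T g (n + 1) x := by linarith
    exact h3
  have hint : ∀ n, Integrable (gM T g n) μ := fun n =>
    Integrable.of_bound (gM_measurable hT.measurable hgm n).aestronglyMeasurable (n * C)
      (Eventually.of_forall fun x => by
        rw [Real.norm_eq_abs, abs_of_nonneg (gM_nonneg _ _ _ _)]
        exact gM_bound T g C hC0 hgC n x)
  have hfint : Integrable f μ := Integrable.of_bound hf.aestronglyMeasurable C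
      (Eventually.of_forall fun x => by
        rw [Real.norm_eq_abs, abs_of_nonneg (hf0 _)]
        exact hfC x)
  have hgint : Integrable g μ := hfint.sub (integrable_const l)
  have key : ∀ n, μ.real (E n) ≤ (∫ x, f x ∂μ) / l := by
    intro n
    have hcomp : Integrable (fun x => gM T g n (T x)) μ :=
      (hT.integrable_comp (hint n).aestronglyMeasurable).2 (hint n)
    have h1 : ∫ x, (gM T g n x - gM T g n (T x)) ∂μ ≤ ∫ x, (E n).indicator g x ∂μ := by
      apply integral_mono ((hint n).sub hcomp) (hgint.indicator (hEm n))
      intro x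
      have hm := gM_mono T g n x
      by_cases hx : x ∈ E n
      · simp only [Set.indicator_of_mem hx]
        have hx' : 0 < gM T g (n + 1) x := hx
        simp only [gM] at hx' hm
        have : max 0 (g x + gM T g n (T x)) = g x + gM T g n (T x) := by
          rcases max_choice 0 (g x + gM T g n (T x)) with h | h
          · rw [h] at hx'; exact absurd hx' (lt_irrefl _)
          · exact h
        rw [this] at hm
        show gM T g n x - gM T g n (T x) ≤ g x
        linarith
      · simp only [Set.indicator_of_notMem hx]
        have hx' : ¬ 0 < gM T g (n + 1) x := hx
        have := gM_nonneg T g n (T x)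
        show gM T g n x - gM T g n (T x) ≤ 0
        linarith
    have h2 : ∫ x, gM T g n (T x) ∂μ = ∫ x, gM T g n x ∂μ := by
      have := integral_map (μ := μ) hT.measurable.aemeasurable
        (f := gM T g n) (by rw [hT.map_eq]; exact (hint n).aestronglyMeasurable)
      rw [hT.map_eq] at this
      exact this.symm
    rw [integral_sub (hint n) hcomp, h2, sub_self, integral_indicator (hEm n)] at h1
    have h3 : ∫ x in E n, g x ∂μ = ∫ x in E n, f x ∂μ - μ.real (E n) * l := by
      simp only [hg]
      rw [integral_sub hfint.integrableOn (integrable_const l)]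
      simp
    have h4 : ∫ x in E n, f x ∂μ ≤ ∫ x, f x ∂μ :=
      setIntegral_le_integral hfint (Eventually.of_forall hf0)
    rw [le_div_iff₀ hl]
    linarith
  have hlim : Tendsto (fun n => μ.real (E n)) atTop (nhds (μ.real (⋃ n, E n))) :=
    (ENNReal.tendsto_toReal (measure_ne_top _ _)).comp (tendsto_measure_iUnion_atTop hEmono)
  exact (measureReal_mono hsub).trans (le_of_tendsto' hlim key)

lemma sum_range_mul_eq (p N : ℕ) (g : ℕ → ℝ) :
    ∑ K ∈ Finset.range (p * N), g K
      = ∑ M ∈ Finset.range N, ∑ a ∈ Finset.range p, g (p * M + a) := by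
  induction N with
  | zero => simp
  | succ N ih => rw [Finset.sum_range_succ, ← ih, mul_add, mul_one, Finset.sum_range_add]

/-- Markov approximations of cylinder weights. -/
noncomputable def Qm (A : ℕ → ℕ → ℝ) (p k : ℕ) : ℕ → ℕ → ℝ
  | 0 => A k
  | j + 1 => fun K => Qm A p k j (K / p) * (A (k + 1) (K % p ^ (k + 1)) / A k (K / p % p ^ k))

lemma Qm_nonneg (A : ℕ → ℕ → ℝ) (p k : ℕ) (hA : ∀ n K, 0 ≤ A n K) (j : ℕ) :
    ∀ K, 0 ≤ Qm A p k j K := by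
  induction j with
  | zero => exact hA k
  | succ j ih => exact fun K => mul_nonneg (ih _) (div_nonneg (hA _ _) (hA _ _))

lemma Qm_sum (A : ℕ → ℕ → ℝ) (p k : ℕ) (hp : 0 < p) (hA : ∀ n K, 0 ≤ A n K)
    (hk : ∑ K ∈ Finset.range (p ^ k), A k K ≤ 1)
    (hs : ∀ M, ∑ a ∈ Finset.range p, A (k + 1) (p * M + a) = A k M) (j : ℕ) :
    ∑ K ∈ Finset.range (p ^ (k + j)), Qm A p k j K ≤ 1 := by
  induction j with
  | zero => simpa [Qm] using hk
  | succ j ih =>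
    rw [← add_assoc, pow_succ', sum_range_mul_eq]
    refine le_trans (Finset.sum_le_sum fun M _ => ?_) ih
    have : ∀ a ∈ Finset.range p, Qm A p k (j + 1) (p * M + a)
        = Qm A p k j M * (A (k + 1) (p * (M % p ^ k) + a) / A k (M % p ^ k)) := by
      intro a ha
      have ha := Finset.mem_range.1 ha
      have h1 : (p * M + a) / p = M := by
        rw [Nat.mul_add_div hp, Nat.div_eq_of_lt ha, add_zero]
      have h2 : (p * M + a) % p ^ (k + 1) = p * (M % p ^ k) + a := by
        rw [pow_succ', Nat.mod_mul, Nat.mul_add_mod, Nat.mod_eq_of_lt ha, h1, add_comm]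
      simp only [Qm, h1, h2]
    rw [Finset.sum_congr rfl this, ← Finset.mul_sum, ← Finset.sum_div, hs]
    exact mul_le_of_le_one_right (Qm_nonneg A p k hA j M) (div_self_le_one _)

lemma integral_comp_index {μ : Measure X} [IsProbabilityMeasure μ] (N : ℕ) {k : X → ℕ}
    (hk : Measurable k) (hN : ∀ x, k x < N) (F : ℕ → ℝ) :
    ∫ x, F (k x) ∂μ = ∑ K ∈ Finset.range N, μ.real (k ⁻¹' {K}) * F K := by
  have h : ∀ x, F (k x) = ∑ K ∈ Finset.range N, (k ⁻¹' {K}).indicator (fun _ => F K) x := by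
    intro x
    rw [Finset.sum_eq_single (k x)]
    · simp
    · intro b _ hb
      rw [Set.indicator_of_notMem]
      exact fun h => hb h.symm
    · intro h
      exact absurd (Finset.mem_range.2 (hN x)) h
  simp_rw [h]
  rw [integral_finsetSum]
  · refine Finset.sum_congr rfl fun K _ => ?_
    rw [integral_indicator_const _ (hk (measurableSet_singleton K)), smul_eq_mul]
  · intro K _
    exact (integrable_const _).indicator (hk (measurableSet_singleton K))

lemma real_preimage_finset {μ : Measure X} [IsProbabilityMeasure μ] {k : X → ℕ}
    (hk : Measurable k) (S : Finset ℕ) :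
    μ.real (k ⁻¹' S) = ∑ K ∈ S, μ.real (k ⁻¹' {K}) := by
  rw [← measureReal_biUnion_finset]
  · congr 1
    ext x
    simp
  · intro a _ b _ hab
    exact Disjoint.preimage _ (by simpa using hab)
  · intro K _
    exact hk (measurableSet_singleton K)

/-- Cylinder entropy. -/
noncomputable def Hent (A : ℕ → ℕ → ℝ) (p n : ℕ) : ℝ :=
  ∑ K ∈ Finset.range (p ^ n), Real.negMulLog (A n K)

theorem abstract_main {μ : Measure X} [IsProbabilityMeasure μ] {T : X → X}
    (hT : MeasurePreserving T μ μ) (p : ℕ) (hp : 2 ≤ p) (k : ℕ → X → ℕ)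
    (hkm : ∀ n, Measurable (k n)) (hlt : ∀ n x, k n x < p ^ n)
    (hdiv : ∀ n x, k n x = k (n + 1) x / p) (hmod : ∀ n x, k n (T x) = k (n + 1) x % p ^ n)
    (A : ℕ → ℕ → ℝ) (hA : ∀ n K, A n K = μ.real (k n ⁻¹' {K}))
    (hH : ∀ η > 0, ∃ n : ℕ, 0 < n ∧ Hent A p n < n * η)
    (ε c : ℝ) (hε : 0 < ε) (hc : 0 < c) :
    ∃ (N : ℕ) (X' : Set X), MeasurableSet X' ∧ μ.real X' > 1 - ε ∧
      ∀ n ≥ N, ∀ x ∈ X', Real.exp (-((n : ℝ) - 1) * c) < A n (k n x) := by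
  have hp0 : 0 < p := by omega
  have hA0 : ∀ n K, 0 ≤ A n K := fun n K => by rw [hA]; exact measureReal_nonneg
  have hA1 : ∀ n K, A n K ≤ 1 := fun n K => by rw [hA]; exact measureReal_le_one
  have hAsum : ∀ n, ∑ K ∈ Finset.range (p ^ n), A n K = 1 := by
    intro n
    simp_rw [hA]
    rw [← real_preimage_finset (hkm n)]
    have : k n ⁻¹' (Finset.range (p ^ n) : Set ℕ) = Set.univ := by
      ext x; simp [hlt]
    rw [this]; simp
  have hAs : ∀ n M, ∑ a ∈ Finset.range p, A (n + 1) (p * M + a) = A n M := by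
    intro n M
    simp_rw [hA]
    have h := real_preimage_finset (μ := μ) (hkm (n + 1))
      ((Finset.range p).image (fun a => p * M + a))
    rw [Finset.sum_image (by intro a _ b _ h; simpa using h)] at h
    rw [← h]
    congr 1
    ext x
    simp only [Set.mem_preimage, Finset.coe_image, Set.mem_image, Finset.coe_range, Set.mem_Iio,
      Set.mem_singleton_iff, hdiv n x]
    constructor
    · rintro ⟨a, ha, h⟩
      rw [← h, Nat.mul_add_div hp0, Nat.div_eq_of_lt ha, add_zero]
    · intro h
      exact ⟨k (n + 1) x % p, Nat.mod_lt _ hp0, by rw [← h]; exact Nat.div_add_mod _ _⟩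
  have hAle : ∀ n K, A (n + 1) K ≤ A n (K / p) := by
    intro n K
    rw [← hAs n (K / p)]
    have := Finset.single_le_sum (f := fun a => A (n + 1) (p * (K / p) + a))
      (fun a _ => hA0 _ _) (Finset.mem_range.2 (Nat.mod_lt K hp0))
    simpa [Nat.div_add_mod] using this
  -- parameters
  set l : ℝ := c / 4 with hl
  have hl0 : 0 < l := by positivity
  obtain ⟨m, hm⟩ : ∃ m : ℕ, Hent A p (m + 1) - Hent A p m < l * ε / 3 := by
    by_contra hcon
    push Not at hcon
    obtain ⟨n, hn, hn'⟩ := hH (l * ε / 3) (by positivity)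
    have h0 : Hent A p 0 = 0 := by
      have h1 : A 0 0 = 1 := by simpa using hAsum 0
      simp [Hent, h1]
    have : ∀ n : ℕ, n * (l * ε / 3) ≤ Hent A p n := by
      intro n
      induction n with
      | zero => simp [h0]
      | succ n ih => have := hcon n; push_cast; linarith
    linarith [this n]
  set F : ℕ → ℝ := fun K => if A (m + 1) K = 0 then 0 else
    Real.log (A m (K / p)) - Real.log (A (m + 1) K) with hF
  have hF0 : ∀ K, 0 ≤ F K := by
    intro K
    simp only [hF]
    split_ifs with h
    · exact le_rfl
    · have : 0 < A (m + 1) K := lt_of_le_of_ne (hA0 _ _) (Ne.symm h)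
      have := Real.log_le_log this (hAle m K)
      linarith
  set f : X → ℝ := fun x => F (k (m + 1) x) with hf
  have hfm : Measurable f := (measurable_from_nat (f := F)).comp (hkm (m + 1))
  have hfint : ∫ x, f x ∂μ = Hent A p (m + 1) - Hent A p m := by
    simp only [hf]
    rw [integral_comp_index (p ^ (m + 1)) (hkm (m + 1)) (hlt (m + 1))]
    simp_rw [← hA]
    have h1 : ∀ K, A (m + 1) K * F K =
        A (m + 1) K * Real.log (A m (K / p)) + Real.negMulLog (A (m + 1) K) := by
      intro K
      simp only [hF, Real.negMulLog]
      split_ifs with h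
      · simp [h]
      · ring
    simp_rw [h1]
    rw [Finset.sum_add_distrib]
    have h2 : ∑ K ∈ Finset.range (p ^ (m + 1)), A (m + 1) K * Real.log (A m (K / p))
        = - Hent A p m := by
      rw [pow_succ', sum_range_mul_eq, Hent, ← Finset.sum_neg_distrib]
      refine Finset.sum_congr rfl fun M _ => ?_
      rw [Real.negMulLog, neg_mul, neg_neg]
      nth_rewrite 1 [← hAs m M]
      rw [Finset.sum_mul]
      refine Finset.sum_congr rfl fun a ha => ?_
      rw [Nat.mul_add_div hp0, Nat.div_eq_of_lt (Finset.mem_range.1 ha), add_zero]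
    rw [h2, Hent, Hent]; ring
  have hfC : ∀ x, f x ≤ ∑ K ∈ Finset.range (p ^ (m + 1)), F K := fun x =>
    Finset.single_le_sum (f := F) (fun K _ => hF0 K) (Finset.mem_range.2 (hlt (m + 1) x))
  -- bad set 1
  set E1 : Set X := {x | ∃ n : ℕ, n * l < birkhoffSum T f n x} with hE1
  have hE1μ : μ.real E1 < ε / 3 := by
    refine (maxerg hT hfm _ (fun x => hF0 _) hfC hl0).trans_lt ?_
    rw [hfint, div_lt_iff₀ hl0]
    linarith
  -- bad set 2
  have hpos : ∀ n, ∀ᵐ x ∂μ, 0 < A n (k n x) := by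
    intro n
    have h : ∀ K, ∀ᵐ x ∂μ, A n K = 0 → k n x ≠ K := by
      intro K
      by_cases h : A n K = 0
      · rw [hA, measureReal_eq_zero_iff] at h
        have : ∀ᵐ x ∂μ, x ∉ k n ⁻¹' {K} := measure_eq_zero_iff_ae_notMem.1 h
        filter_upwards [this] with x hx _ h
        exact hx h
      · exact Eventually.of_forall fun x h' => absurd h' h
    filter_upwards [ae_all_iff.2 h] with x hx
    refine lt_of_le_of_ne (hA0 _ _) fun h0 => hx _ h0.symm rfl
  have hposT : ∀ᵐ x ∂μ, ∀ n j, 0 < A n (k n (T^[j] x)) := by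
    rw [ae_all_iff]; intro n
    rw [ae_all_iff]; intro j
    exact (hT.iterate j).quasiMeasurePreserving.ae (hpos n)
  set E2 : Set X := {x | ¬ ∀ n j, 0 < A n (k n (T^[j] x))} with hE2
  have hE2μ : μ.real E2 = 0 := by
    rw [measureReal_eq_zero_iff]; exact hposT
  -- bad set 3
  set r : ℝ := Real.exp (-l) with hr
  have hr0 : 0 < r := Real.exp_pos _
  have hr1 : r < 1 := by rw [hr, Real.exp_lt_one_iff]; linarith
  set B : ℕ → Set X := fun j =>
    {x | A (m + j) (k (m + j) x) < Qm A p m j (k (m + j) x) * r ^ j} with hB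
  have hBμ : ∀ j, μ.real (B j) ≤ r ^ j := by
    intro j
    classical
    set S : Finset ℕ := (Finset.range (p ^ (m + j))).filter
      (fun K => A (m + j) K < Qm A p m j K * r ^ j) with hS
    have h1 : B j = k (m + j) ⁻¹' S := by
      ext x
      simp [hB, hS, hlt]
    rw [h1, real_preimage_finset (hkm _)]
    simp_rw [← hA]
    calc ∑ K ∈ S, A (m + j) K ≤ ∑ K ∈ S, Qm A p m j K * r ^ j :=
          Finset.sum_le_sum fun K hK => (Finset.mem_filter.1 hK).2.le
      _ ≤ ∑ K ∈ Finset.range (p ^ (m + j)), Qm A p m j K * r ^ j :=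
          Finset.sum_le_sum_of_subset_of_nonneg (Finset.filter_subset _ _)
            fun K _ _ => mul_nonneg (Qm_nonneg A p m hA0 j K) (by positivity)
      _ = (∑ K ∈ Finset.range (p ^ (m + j)), Qm A p m j K) * r ^ j := by rw [Finset.sum_mul]
      _ ≤ 1 * r ^ j := by
          gcongr
          exact Qm_sum A p m hp0 hA0 (hAsum m).le (hAs m) j
      _ = r ^ j := one_mul _
  obtain ⟨J1, hJ1⟩ : ∃ J : ℕ, r ^ J / (1 - r) < ε / 3 := by
    have : Tendsto (fun J : ℕ => r ^ J / (1 - r)) atTop (nhds (0 / (1 - r))) :=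
      (tendsto_pow_atTop_nhds_zero_of_lt_one hr0.le hr1).div_const _
    rw [zero_div] at this
    exact (this.eventually_lt_const (by positivity)).exists
  set C : ℝ := ∑ K ∈ Finset.range (p ^ m), |Real.log (A m K)| with hC
  obtain ⟨J2, hJ2⟩ := exists_nat_gt ((C + 4 * l) / (2 * l))
  set J : ℕ := max J1 J2 with hJ
  set E3 : Set X := ⋃ i, B (J1 + i) with hE3
  have hE3μ : μ.real E3 < ε / 3 := by
    have hgs : HasSum (fun i : ℕ => r ^ (J1 + i)) (r ^ J1 / (1 - r)) := by
      simp_rw [pow_add]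
      rw [div_eq_mul_inv]
      exact (hasSum_geometric_of_lt_one hr0.le hr1).mul_left _
    refine lt_of_le_of_lt ?_ hJ1
    have h1 : μ E3 ≤ ENNReal.ofReal (r ^ J1 / (1 - r)) := by
      rw [← hgs.tsum_eq, ENNReal.ofReal_tsum_of_nonneg (fun i => by positivity) hgs.summable]
      refine (measure_iUnion_le _).trans (ENNReal.tsum_le_tsum fun i => ?_)
      rw [← ofReal_measureReal]
      exact ENNReal.ofReal_le_ofReal (hBμ _)
    have h2 : 0 ≤ r ^ J1 / (1 - r) := div_nonneg (by positivity) (by linarith)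
    exact ENNReal.toReal_le_of_le_ofReal h2 h1
  set Bad : Set X := E1 ∪ E2 ∪ E3 with hBad
  have hBadμ : μ.real Bad < ε := by
    have h1 := measureReal_union_le (μ := μ) (E1 ∪ E2) E3
    have h2 := measureReal_union_le (μ := μ) E1 E2
    linarith
  refine ⟨m + J, (toMeasurable μ Bad)ᶜ, (measurableSet_toMeasurable _ _).compl, ?_, ?_⟩
  · rw [measureReal_compl (measurableSet_toMeasurable _ _)]
    have : μ.real (toMeasurable μ Bad) = μ.real Bad := by
      simp [Measure.real, measure_toMeasurable]
    rw [this]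
    simp
    linarith
  intro n hn x hx
  have hxB : x ∉ Bad := fun h => hx (subset_toMeasurable _ _ h)
  have hx1 : x ∉ E1 := fun h => hxB (Or.inl (Or.inl h))
  have hx2 : x ∉ E2 := fun h => hxB (Or.inl (Or.inr h))
  have hx3 : x ∉ E3 := fun h => hxB (Or.inr h)
  have hx2' : ∀ n j, 0 < A n (k n (T^[j] x)) := not_not.1 hx2
  have hx1' : ∀ j : ℕ, birkhoffSum T f j x ≤ j * l := fun j => by
    by_contra h
    exact hx1 ⟨j, not_le.1 h⟩
  obtain ⟨j, rfl⟩ : ∃ j, n = m + j := ⟨n - m, by omega⟩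
  have hj1 : J1 ≤ j := by have := le_max_left J1 J2; omega
  have hj2 : J2 ≤ j := by have := le_max_right J1 J2; omega
  have hx3' : Qm A p m j (k (m + j) x) * r ^ j ≤ A (m + j) (k (m + j) x) := by
    by_contra h
    refine hx3 (Set.mem_iUnion.2 ⟨j - J1, ?_⟩)
    have : J1 + (j - J1) = j := by omega
    rw [this]
    exact not_le.1 h
  have hmodj : ∀ j n y, k n (T^[j] y) = k (n + j) y % p ^ n := by
    intro j
    induction j with
    | zero => intro n y; simp [Nat.mod_eq_of_lt (hlt n y)]
    | succ j ih =>
      intro n y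
      rw [Function.iterate_succ_apply, ih, hmod, Nat.mod_mod_of_dvd _ (pow_dvd_pow p (by omega)),
        add_assoc]
  have hQ : ∀ j, 0 < Qm A p m j (k (m + j) x) ∧ Real.log (Qm A p m j (k (m + j) x))
      = Real.log (A m (k m x)) - birkhoffSum T f j x := by
    intro j
    induction j with
    | zero => simpa [Qm] using hx2' m 0
    | succ j ih =>
      have e1 : k (m + (j + 1)) x / p = k (m + j) x := (hdiv (m + j) x).symm
      have e2 : k (m + (j + 1)) x % p ^ (m + 1) = k (m + 1) (T^[j] x) := by
        rw [hmodj]; congr 2; omega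
      have e3 : k (m + j) x % p ^ m = k m (T^[j] x) := (hmodj _ _ _).symm
      have p1 := hx2' (m + 1) j
      have p2 := hx2' m j
      simp only [Qm, e1, e2, e3]
      refine ⟨mul_pos ih.1 (div_pos p1 p2), ?_⟩
      rw [Real.log_mul ih.1.ne' (div_pos p1 p2).ne', ih.2, Real.log_div p1.ne' p2.ne',
        birkhoffSum_succ]
      have : f (T^[j] x) = Real.log (A m (k m (T^[j] x)))
          - Real.log (A (m + 1) (k (m + 1) (T^[j] x))) := by
        simp only [hf, hF, if_neg p1.ne', ← hdiv]
      rw [this]; ring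
  have hlogA : Real.log (Qm A p m j (k (m + j) x) * r ^ j) ≤ Real.log (A (m + j) (k (m + j) x)) :=
    Real.log_le_log (mul_pos (hQ j).1 (by positivity)) hx3'
  rw [Real.log_mul (hQ j).1.ne' (by positivity), (hQ j).2, Real.log_pow, hr, Real.log_exp] at hlogA
  have hCb : -C ≤ Real.log (A m (k m x)) := by
    have h1 := Finset.single_le_sum (f := fun K => |Real.log (A m K)|) (fun K _ => abs_nonneg _)
      (Finset.mem_range.2 (hlt m x))
    have h2 := neg_abs_le (Real.log (A m (k m x)))
    linarith
  have hb := hx1' j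
  have hjl : C + 4 * l < 2 * l * j := by
    rw [div_lt_iff₀ (by positivity)] at hJ2
    have : (J2 : ℝ) ≤ j := by exact_mod_cast hj2
    nlinarith
  have hApos : 0 < A (m + j) (k (m + j) x) := by simpa using hx2' (m + j) 0
  rw [← Real.lt_log_iff_exp_lt hApos]
  have hcl : c = 4 * l := by rw [hl]; ring
  have hml : 0 ≤ (m : ℝ) * l := by positivity
  push_cast
  rw [hcl]
  nlinarith

lemma Hent_le (A : ℕ → ℕ → ℝ) (p n : ℕ) (hp : 0 < p) (hA0 : ∀ n K, 0 ≤ A n K)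
    (hAsum : ∑ K ∈ Finset.range (p ^ n), A n K = 1) : Hent A p n ≤ n * Real.log p := by
  have hN : (0 : ℝ) < (p : ℝ) ^ n := by positivity
  have h : ∀ K ∈ Finset.range (p ^ n), Real.negMulLog (A n K)
      ≤ A n K * (n * Real.log p) + (1 / (p : ℝ) ^ n - A n K) := by
    intro K _
    rcases (hA0 n K).eq_or_lt with h | h
    · rw [← h]; simp
    · have h1 := Real.log_le_sub_one_of_pos (x := 1 / ((p : ℝ) ^ n * A n K)) (by positivity)
      rw [one_div, Real.log_inv, Real.log_mul hN.ne' h.ne', Real.log_pow] at h1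
      have h2 := mul_le_mul_of_nonneg_left h1 h.le
      have h3 : A n K * (((p : ℝ) ^ n * A n K)⁻¹ - 1) = 1 / (p : ℝ) ^ n - A n K := by
        field_simp
      rw [h3] at h2
      rw [Real.negMulLog]
      linarith
  refine (Finset.sum_le_sum h).trans ?_
  rw [Finset.sum_add_distrib, ← Finset.sum_mul, Finset.sum_sub_distrib, hAsum]
  simp [hN.ne']

end Abstract

section Circle

lemma arc_exists (p : ℕ) (hp : 0 < p) (n : ℕ) (x : AddCircle (1:ℝ)) :
    ∃ K : ℕ, K < p ^ n ∧ x ∈ arc ((K : ℝ) / (p : ℝ) ^ n) (((K : ℝ) + 1) / (p : ℝ) ^ n) := by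
  have hN : (0 : ℝ) < (p : ℝ) ^ n := by positivity
  obtain ⟨t, ht, rfl⟩ : ∃ t : ℝ, t ∈ Set.Ioc (0:ℝ) 1 ∧ (t : AddCircle (1:ℝ)) = x := by
    refine ⟨(AddCircle.equivIoc 1 0 x : ℝ), ?_, ?_⟩
    · have := (AddCircle.equivIoc (1:ℝ) 0 x).2
      simpa using this
    · exact (AddCircle.equivIoc (1:ℝ) 0).symm_apply_apply x
  have hpos : 0 < ⌈t * (p : ℝ) ^ n⌉₊ := Nat.ceil_pos.2 (mul_pos ht.1 hN)
  obtain ⟨K, hK⟩ : ∃ K, ⌈t * (p : ℝ) ^ n⌉₊ = K + 1 := ⟨_, (Nat.succ_pred_eq_of_pos hpos).symm⟩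
  have h1 : t * (p : ℝ) ^ n ≤ K + 1 := by
    have := Nat.le_ceil (t * (p : ℝ) ^ n)
    rw [hK] at this; exact_mod_cast this
  have h2 : (K : ℝ) < t * (p : ℝ) ^ n := Nat.lt_ceil.1 (by omega)
  refine ⟨K, ?_, t, ⟨?_, ?_⟩, rfl⟩
  · have : (K : ℝ) < ((p ^ n : ℕ) : ℝ) := by
      push_cast
      nlinarith [ht.2]
    exact_mod_cast this
  · rwa [div_lt_iff₀ hN]
  · rwa [le_div_iff₀ hN]

lemma arc_sub (p : ℕ) (hp : 0 < p) (n K : ℕ) (hK : K < p ^ n) :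
    Set.Ioc ((K : ℝ) / (p : ℝ) ^ n) (((K : ℝ) + 1) / (p : ℝ) ^ n) ⊆ Set.Ioc (0:ℝ) (0 + 1) := by
  have hN : (0 : ℝ) < (p : ℝ) ^ n := by positivity
  intro t ht
  have : (K : ℝ) + 1 ≤ (p : ℝ) ^ n := by exact_mod_cast hK
  refine ⟨lt_of_le_of_lt (by positivity) ht.1, ht.2.trans ?_⟩
  rw [zero_add, div_le_one hN]
  exact this

lemma arc_unique (p : ℕ) (hp : 0 < p) (n K L : ℕ) (hK : K < p ^ n) (hL : L < p ^ n)
    (x : AddCircle (1:ℝ))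
    (h1 : x ∈ arc ((K : ℝ) / (p : ℝ) ^ n) (((K : ℝ) + 1) / (p : ℝ) ^ n))
    (h2 : x ∈ arc ((L : ℝ) / (p : ℝ) ^ n) (((L : ℝ) + 1) / (p : ℝ) ^ n)) : K = L := by
  have hN : (0 : ℝ) < (p : ℝ) ^ n := by positivity
  obtain ⟨t, ht, rfl⟩ := h1
  obtain ⟨s, hs, hst⟩ := h2
  have : Fact ((0:ℝ) < 1) := ⟨one_pos⟩
  have := (AddCircle.coe_eq_coe_iff_of_mem_Ioc (arc_sub p hp n L hL hs)
    (arc_sub p hp n K hK ht)).1 hst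
  subst this
  have a1 := (div_lt_iff₀ hN).1 ht.1
  have a2 := (le_div_iff₀ hN).1 ht.2
  have b1 := (div_lt_iff₀ hN).1 hs.1
  have b2 := (le_div_iff₀ hN).1 hs.2
  have c1 : (K : ℝ) < L + 1 := by linarith
  have c2 : (L : ℝ) < K + 1 := by linarith
  have c1' : K < L + 1 := by exact_mod_cast c1
  have c2' : L < K + 1 := by exact_mod_cast c2
  omega

lemma arc_measurable (p : ℕ) (hp : 0 < p) (n K : ℕ) (hK : K < p ^ n) :
    MeasurableSet (arc ((K : ℝ) / (p : ℝ) ^ n) (((K : ℝ) + 1) / (p : ℝ) ^ n)) := by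
  have : Fact ((0:ℝ) < 1) := ⟨one_pos⟩
  refine measurableSet_Ioc.image_of_continuousOn_injOn
    (AddCircle.continuous_mk' (1:ℝ)).continuousOn ?_
  intro t ht s hs h
  exact (AddCircle.coe_eq_coe_iff_of_mem_Ioc (arc_sub p hp n K hK ht)
    (arc_sub p hp n K hK hs)).1 h

lemma arc_div (p : ℕ) (hp : 0 < p) (n K : ℕ) (x : AddCircle (1:ℝ))
    (h : x ∈ arc ((K : ℝ) / (p : ℝ) ^ (n + 1)) (((K : ℝ) + 1) / (p : ℝ) ^ (n + 1))) :
    x ∈ arc (((K / p : ℕ) : ℝ) / (p : ℝ) ^ n) ((((K / p : ℕ) : ℝ) + 1) / (p : ℝ) ^ n) := by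
  have hN : (0 : ℝ) < (p : ℝ) ^ n := by positivity
  have hN' : (0 : ℝ) < (p : ℝ) ^ (n + 1) := by positivity
  have hp' : (0 : ℝ) < p := by positivity
  obtain ⟨t, ht, rfl⟩ := h
  have a1 := (div_lt_iff₀ hN').1 ht.1
  have a2 := (le_div_iff₀ hN').1 ht.2
  have e1 : p * (K / p) ≤ K := Nat.mul_div_le K p
  have e2 : K + 1 ≤ p * (K / p + 1) := Nat.lt_mul_div_succ K hp
  have e1' : (p : ℝ) * ((K / p : ℕ) : ℝ) ≤ K := by exact_mod_cast e1
  have e2' : (K : ℝ) + 1 ≤ (p : ℝ) * (((K / p : ℕ) : ℝ) + 1) := by exact_mod_cast e2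
  rw [pow_succ] at a1 a2
  refine ⟨t, ⟨?_, ?_⟩, rfl⟩
  · rw [div_lt_iff₀ hN]
    refine lt_of_mul_lt_mul_left (a := (p : ℝ)) ?_ hp'.le
    linarith
  · rw [le_div_iff₀ hN]
    refine le_of_mul_le_mul_left (a := (p : ℝ)) ?_ hp'
    linarith

lemma arc_mod (p : ℕ) (hp : 0 < p) (n K : ℕ) (x : AddCircle (1:ℝ))
    (h : x ∈ arc ((K : ℝ) / (p : ℝ) ^ (n + 1)) (((K : ℝ) + 1) / (p : ℝ) ^ (n + 1))) :
    p • x ∈ arc (((K % p ^ n : ℕ) : ℝ) / (p : ℝ) ^ n)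
      ((((K % p ^ n : ℕ) : ℝ) + 1) / (p : ℝ) ^ n) := by
  have hN : (0 : ℝ) < (p : ℝ) ^ n := by positivity
  have hN' : (0 : ℝ) < (p : ℝ) ^ (n + 1) := by positivity
  obtain ⟨t, ht, rfl⟩ := h
  have a1 := (div_lt_iff₀ hN').1 ht.1
  have a2 := (le_div_iff₀ hN').1 ht.2
  have e : p ^ n * (K / p ^ n) + K % p ^ n = K := Nat.div_add_mod K _
  have e' : (p : ℝ) ^ n * ((K / p ^ n : ℕ) : ℝ) + ((K % p ^ n : ℕ) : ℝ) = K := by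
    exact_mod_cast e
  rw [pow_succ] at a1 a2
  refine ⟨p * t - ((K / p ^ n : ℕ) : ℝ), ⟨?_, ?_⟩, ?_⟩
  · rw [div_lt_iff₀ hN]
    linarith
  · rw [le_div_iff₀ hN]
    linarith
  · have h1 : (((K / p ^ n : ℕ) : ℝ) : AddCircle (1:ℝ)) = 0 := by
      rw [AddCircle.coe_eq_zero_iff]
      exact ⟨((K / p ^ n : ℕ) : ℤ), by rw [zsmul_one, Int.cast_natCast]⟩
    simp only [AddCircle.coe_sub, h1, sub_zero]
    rw [← nsmul_eq_mul, AddCircle.coe_nsmul]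

lemma arc_ball (p : ℕ) (hp : 0 < p) (n K : ℕ) (x : AddCircle (1:ℝ)) (δ : ℝ)
    (hδ : 1 / (p : ℝ) ^ n ≤ δ)
    (h : x ∈ arc ((K : ℝ) / (p : ℝ) ^ n) (((K : ℝ) + 1) / (p : ℝ) ^ n)) :
    arc ((K : ℝ) / (p : ℝ) ^ n) (((K : ℝ) + 1) / (p : ℝ) ^ n) ⊆ Metric.ball x δ := by
  obtain ⟨t, ht, rfl⟩ := h
  rintro _ ⟨s, hs, rfl⟩
  rw [add_div] at ht hs
  have h1 : |s - t| < 1 / (p : ℝ) ^ n := by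
    rw [abs_lt]
    constructor <;> linarith [ht.1, ht.2, hs.1, hs.2]
  rw [Metric.mem_ball, dist_eq_norm]
  simp only [← AddCircle.coe_sub]
  refine lt_of_le_of_lt ?_ (h1.trans_le hδ)
  exact QuotientAddGroup.norm_mk_le_norm

end Circle

theorem stmt1 (p : ℕ) (hp : 2 ≤ p) (μ : Measure (AddCircle (1:ℝ)))
    [IsProbabilityMeasure μ]
    (hinv : ∀ s : Set (AddCircle (1:ℝ)), MeasurableSet s →
      μ ((fun x : AddCircle (1:ℝ) => p • x) ⁻¹' s) = μ s)
    (hent : padicEntropy p μ = 0) :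
    ∀ ε > (0:ℝ), ∀ β > (0:ℝ), ∃ δ₀ > (0:ℝ), ∃ X' : Set (AddCircle (1:ℝ)),
      MeasurableSet X' ∧ (μ X').toReal > 1 - ε ∧
      ∀ δ : ℝ, 0 < δ → δ ≤ δ₀ → ∀ x ∈ X',
        (μ (Metric.ball x δ)).toReal > δ ^ β := by
  intro ε hε β hβ
  have hp0 : 0 < p := by omega
  have hp1 : (1 : ℝ) < p := by exact_mod_cast (by omega : 1 < p)
  have hlogp : 0 < Real.log p := Real.log_pos hp1
  have hTm : Measurable (fun x : AddCircle (1:ℝ) => p • x) :=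
    (continuous_nsmul p).measurable
  have hT : MeasurePreserving (fun x : AddCircle (1:ℝ) => p • x) μ μ := by
    refine ⟨hTm, Measure.ext fun s hs => ?_⟩
    rw [Measure.map_apply hTm hs, hinv s hs]
  choose k hlt hmem using arc_exists p hp0
  have huniq : ∀ n x K, K < p ^ n →
      x ∈ arc ((K : ℝ) / (p : ℝ) ^ n) (((K : ℝ) + 1) / (p : ℝ) ^ n) → k n x = K :=
    fun n x K hK hx => arc_unique p hp0 n _ _ (hlt n x) hK x (hmem n x) hx
  have hpre : ∀ n K, K < p ^ n →
      k n ⁻¹' {K} = arc ((K : ℝ) / (p : ℝ) ^ n) (((K : ℝ) + 1) / (p : ℝ) ^ n) := by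
    intro n K hK
    ext x
    constructor
    · intro h
      have h' : k n x = K := h
      have := hmem n x
      rwa [h'] at this
    · exact fun h => huniq n x K hK h
  have hkm : ∀ n, Measurable (k n) := by
    intro n
    refine measurable_to_countable' fun K => ?_
    by_cases hK : K < p ^ n
    · rw [hpre n K hK]; exact arc_measurable p hp0 n K hK
    · have : k n ⁻¹' {K} = ∅ := by
        ext x
        simp only [Set.mem_preimage, Set.mem_singleton_iff, Set.mem_empty_iff_false, iff_false]
        rintro rfl
        exact hK (hlt n x)
      rw [this]; exact MeasurableSet.empty
  have hdiv : ∀ n x, k n x = k (n + 1) x / p := by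
    intro n x
    refine huniq n x _ ?_ (arc_div p hp0 n _ x (hmem (n + 1) x))
    rw [Nat.div_lt_iff_lt_mul hp0, ← pow_succ]
    exact hlt (n + 1) x
  have hmod : ∀ n x, k n (p • x) = k (n + 1) x % p ^ n := by
    intro n x
    exact huniq n _ _ (Nat.mod_lt _ (by positivity)) (arc_mod p hp0 n _ x (hmem (n + 1) x))
  set A : ℕ → ℕ → ℝ := fun n K => μ.real (k n ⁻¹' {K}) with hA
  have hA0 : ∀ n K, 0 ≤ A n K := fun n K => measureReal_nonneg
  have hAsum : ∀ n, ∑ K ∈ Finset.range (p ^ n), A n K = 1 := by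
    intro n
    simp only [hA]
    rw [← real_preimage_finset (hkm n)]
    have : k n ⁻¹' (Finset.range (p ^ n) : Set ℕ) = Set.univ := by
      ext x; simp [hlt]
    rw [this]; simp
  have hH : ∀ η > 0, ∃ n : ℕ, 0 < n ∧ Hent A p n < n * η := by
    intro η hη
    have hlim : atTop.limsup (fun n : ℕ => (1 / (n : ℝ)) * Hent A p n) = 0 := by
      rw [← hent, padicEntropy]
      congr 1
      ext n
      congr 1
      refine Finset.sum_congr rfl fun K hK => ?_
      simp only [hA, hpre n K (Finset.mem_range.1 hK), Measure.real]
    have hbdd : IsBoundedUnder (· ≤ ·) atTop (fun n : ℕ => (1 / (n : ℝ)) * Hent A p n) := by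
      refine isBoundedUnder_of ⟨Real.log p, fun n => ?_⟩
      rcases Nat.eq_zero_or_pos n with h | h
      · subst h; simp [hlogp.le]
      · have h1 := Hent_le A p n hp0 hA0 (hAsum n)
        have hn : (0 : ℝ) < n := by exact_mod_cast h
        rw [one_div, inv_mul_le_iff₀ hn]
        exact h1
    have hev := eventually_lt_of_limsup_lt (hlim.trans_lt hη) hbdd
    obtain ⟨n, hn, hn0⟩ := (hev.and (eventually_gt_atTop 0)).exists
    refine ⟨n, hn0, ?_⟩
    have hn' : (0 : ℝ) < n := by exact_mod_cast hn0
    rwa [one_div, inv_mul_lt_iff₀ hn'] at hn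
  obtain ⟨N, X', hX'm, hX', hN⟩ := abstract_main hT p hp k hkm hlt hdiv hmod A (fun _ _ => rfl) hH
    ε (β * Real.log p) hε (by positivity)
  refine ⟨((p : ℝ)⁻¹) ^ N, by positivity, X', hX'm, hX', ?_⟩
  intro δ hδ0 hδ x hx
  have hpi : (p : ℝ)⁻¹ < 1 := inv_lt_one_of_one_lt₀ hp1
  have hpi0 : 0 < (p : ℝ)⁻¹ := by positivity
  obtain ⟨n, hn1, hn2⟩ := exists_nat_pow_near_of_lt_one hδ0
    (hδ.trans (pow_le_one₀ hpi0.le hpi.le)) hpi0 hpi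
  have hNn : N ≤ n + 1 := by
    have := (pow_lt_pow_iff_right_of_lt_one₀ hpi0 hpi).1 (hn1.trans_le hδ)
    omega
  have h1 := hN (n + 1) hNn x hx
  have h2 : A (n + 1) (k (n + 1) x) ≤ μ.real (Metric.ball x δ) := by
    simp only [hA]
    rw [hpre _ _ (hlt _ _)]
    refine measureReal_mono (arc_ball p hp0 _ _ x δ ?_ (hmem _ _))
    rw [one_div, ← inv_pow]
    exact hn1.le
  refine lt_of_le_of_lt ?_ (h1.trans_le h2)
  calc δ ^ β ≤ (((p : ℝ)⁻¹) ^ n) ^ β := Real.rpow_le_rpow hδ0.le hn2 hβ.le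
    _ = Real.exp (-(((n + 1 : ℕ) : ℝ) - 1) * (β * Real.log p)) := by
      rw [Real.rpow_def_of_pos (by positivity), Real.log_pow, Real.log_inv]
      congr 1
      push_cast
      ring
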